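/- arXiv:1011.4132 — 7 statements merged into one kernel-verified Lean document; each statement's English description precedes it below -/
import Mathlib

section
/- For every q ≥ 2 and all indices 0 ≤ i < j ≤ q, the face maps of the simplicial group K(A,2) satisfy ∂_i ∘ ∂_j = ∂_{j-1} ∘ ∂_i as group homomorphisms K_q → K_{q-2}. -/
/-!
Explicit simplicial group `K(A,2)` (Staic).  Degree `q` part is
`K2 A q = A^{q(q-1)/2}`, functions on pairs `0 ≤ u < v ≤ q-1`.
-/

/-- Index set for `K(A,2)` in degree `q`: pairs `(u,v)` with `0 ≤ u < v ≤ q-1`. -/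
abbrev P2 (q : ℕ) : Type := {p : ℕ × ℕ // p.1 < p.2 ∧ p.2 < q}

/-- `K(A,2)` in degree `q`. -/
abbrev K2 (A : Type*) [CommGroup A] (q : ℕ) : Type _ := P2 q → A

variable {A : Type*} [CommGroup A]

/-- The face map `∂ᵢ : K_{q+1} → K_q` of `K(A,2)`:
`b_{u,v} = a_{u,v}` if `u < v < i-1`, `b_{u,v} = a_{u,v} a_{u,i} a_{v,i}⁻¹` if `u < v = i-1`,
`b_{u,v} = a_{u,v+1}` if `u ≤ i-1 < v`, and `b_{u,v} = a_{u+1,v+1}` if `i-1 < u < v`. -/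
def del2 (q i : ℕ) (a : K2 A (q + 1)) : K2 A q := fun p =>
  have h1 : p.1.1 < p.1.2 := p.2.1
  have h2 : p.1.2 < q := p.2.2
  if h : p.1.2 + 1 < i then a ⟨(p.1.1, p.1.2), by omega⟩
  else if hv : p.1.2 + 1 = i then
    a ⟨(p.1.1, p.1.2), by omega⟩ * a ⟨(p.1.1, i), by omega⟩ * (a ⟨(p.1.2, i), by omega⟩)⁻¹
  else if p.1.1 < i then a ⟨(p.1.1, p.1.2 + 1), by omega⟩
  else a ⟨(p.1.1 + 1, p.1.2 + 1), by omega⟩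

/-- The degeneracy map `sᵢ : K_q → K_{q+1}` of `K(A,2)`:
`c_{u,v} = a_{u,v}` if `u < v < i`, `c_{u,v} = 1` if `u < v = i`,
`c_{u,v} = a_{u,v-1}` if `u < i < v` or `u = i < v-1`, `c_{u,v} = 1` if `u = i = v-1`,
and `c_{u,v} = a_{u-1,v-1}` if `i < u < v`. -/
def s2 (q i : ℕ) (hi : i ≤ q) (a : K2 A q) : K2 A (q + 1) := fun p =>
  have h1 : p.1.1 < p.1.2 := p.2.1
  have h2 : p.1.2 < q + 1 := p.2.2
  if h : p.1.2 < i then a ⟨(p.1.1, p.1.2), by omega⟩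
  else if h' : p.1.2 = i then 1
  else if hu : p.1.1 < i then a ⟨(p.1.1, p.1.2 - 1), by omega⟩
  else if hu' : p.1.1 = i then
    (if hv : p.1.2 = i + 1 then 1 else a ⟨(p.1.1, p.1.2 - 1), by omega⟩)
  else a ⟨(p.1.1 - 1, p.1.2 - 1), by omega⟩

/-- The cyclic operator `τ_q : K_q → K_q` of `K(A,2)`:
`e_{0,v} = a_{v-1,v} ⋯ a_{v-1,q-1} · a_{v,v+1}⁻¹ ⋯ a_{v,q-1}⁻¹` and
`e_{u,v} = a_{u-1,v-1}` for `0 < u < v`. -/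
def tau2 (q : ℕ) (a : K2 A q) : K2 A q := fun p =>
  have h1 : p.1.1 < p.1.2 := p.2.1
  have h2 : p.1.2 < q := p.2.2
  if h : p.1.1 = 0 then
    (∏ t ∈ (Finset.Ico p.1.2 q).attach,
        a ⟨(p.1.2 - 1, t.1), by have := Finset.mem_Ico.mp t.2; omega⟩) *
    (∏ t ∈ (Finset.Ico (p.1.2 + 1) q).attach,
        (a ⟨(p.1.2, t.1), by have := Finset.mem_Ico.mp t.2; omega⟩)⁻¹)
  else a ⟨(p.1.1 - 1, p.1.2 - 1), by omega⟩

/-- The formula for `∂ᵢ`, applied to a family indexed by all pairs of natural numbers. -/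
def totalFace (i : ℕ) (F : ℕ → ℕ → A) (u v : ℕ) : A :=
  if v + 1 < i then F u v
  else if v + 1 = i then F u v * F u i * (F v i)⁻¹
  else if u < i then F u (v + 1)
  else F (u + 1) (v + 1)

theorem totalFace_totalFace {i j u v : ℕ} (hij : i ≤ j) (huv : u < v) (F : ℕ → ℕ → A) :
    totalFace i (totalFace (j + 1) F) u v = totalFace j (totalFace i F) u v := by
  rcases lt_trichotomy (v + 1) i with hi | rfl | hi
  · simp (disch := omega) only [totalFace, if_pos, if_neg]
  · rcases hij.eq_or_lt with rfl | hj
    · simp (disch := omega) only [totalFace, if_pos, if_neg]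
      simp only [← div_eq_mul_inv]
      rw [mul_div_assoc, div_div_div_cancel_right, mul_div_mul_comm, ← mul_assoc, ← mul_div_assoc,
        ← mul_div_assoc]
    · simp (disch := omega) only [totalFace, if_pos, if_neg]
  · rcases lt_or_ge u i with hu | hu
    · rcases lt_trichotomy (v + 1) j with hj | rfl | hj <;>
        simp (disch := omega) only [totalFace, if_pos, if_neg]
    · rcases lt_trichotomy (v + 1) j with hj | rfl | hj
      · simp (disch := omega) only [totalFace, if_pos, if_neg]
      · simp (disch := omega) only [totalFace, if_pos, if_neg]
      · rcases lt_or_ge u j with hj' | hj' <;>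
          simp (disch := omega) only [totalFace, if_pos, if_neg]

theorem del2_restrict (q i : ℕ) (F : ℕ → ℕ → A) :
    del2 q i (fun p => F p.1.1 p.1.2) = fun p => totalFace i F p.1.1 p.1.2 := by
  funext p
  simp only [del2, totalFace, dite_eq_ite]

theorem exists_eq_restrict {q : ℕ} (a : K2 A q) :
    ∃ F : ℕ → ℕ → A, a = fun p => F p.1.1 p.1.2 :=
  ⟨fun u v => if h : u < v ∧ v < q then a ⟨(u, v), h⟩ else 1, by
    funext p
    simp only [p.2, and_self, dite_true]⟩

/-- For every `q ≥ 2` (here `q+2`) and all `0 ≤ i < j ≤ q`, the face maps of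
the simplicial group `K(A,2)` satisfy `∂ᵢ ∘ ∂ⱼ = ∂_{j-1} ∘ ∂ᵢ` as group homomorphisms
`K_q → K_{q-2}`. -/
theorem K2_face_face (A : Type*) [CommGroup A] (q i j : ℕ) (hij : i < j) (hj : j ≤ q + 2) :
    (del2 (A := A) q i) ∘ (del2 (q + 1) j) = (del2 q (j - 1)) ∘ (del2 (q + 1) i) := by
  funext a p
  obtain ⟨F, rfl⟩ := exists_eq_restrict a
  obtain ⟨k, rfl⟩ : ∃ k, j = k + 1 := ⟨j - 1, by omega⟩
  simp only [Function.comp_apply, del2_restrict, Nat.add_sub_cancel]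
  exact totalFace_totalFace (by omega) p.2.1 F
end

section
/- For every q ≠ 2, the Moore complex of K(A,2) is trivial in degree q: if an element (a_{u,v}) ∈ K_q satisfies ∂_i((a_{u,v})) = 1 for all 0 ≤ i ≤ q−1, then (a_{u,v}) = 1. Consequently the homotopy groups of the simplicial group K(A,2) are π_2 ≅ A and π_q = 0 for q ≠ 2. -/
variable {A : Type*} [CommGroup A]

/-- For every `q ≠ 2` the Moore complex of `K(A,2)` is trivial in degree `q`:
if `a ∈ K_q` satisfies `∂ᵢ a = 1` for all `0 ≤ i ≤ q-1` then `a = 1`.  Consequently (the Moore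
complex being all of `K_2 ≅ A` in degree `2`, with trivial differentials in and out) the
homotopy groups of `K(A,2)` are `π₂ ≅ A` and `π_q = 0` for `q ≠ 2`. -/
theorem K2_moore_trivial (A : Type*) [CommGroup A] :
    (∀ a : K2 A 0, a = 1) ∧
    (∀ q : ℕ, q + 1 ≠ 2 → ∀ a : K2 A (q + 1),
      (∀ i : ℕ, i ≤ q → del2 q i a = 1) → a = 1) ∧
    (∀ a : K2 A 2, ∀ i : ℕ, i ≤ 1 → del2 1 i a = 1) ∧
    Nonempty (K2 A 2 ≃* A) := by
  refine ⟨fun a => ?_, fun q hq a ha => ?_, fun a i _ => ?_, ?_⟩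
  · funext p
    exact absurd p.2.2 (Nat.not_lt_zero _)
  · have face_zero : ∀ u v, ∀ h : u + 1 < v + 1 ∧ v + 1 < q + 1, a ⟨(u + 1, v + 1), h⟩ = 1 := by
      intro u v h
      simpa [del2] using congrFun (ha 0 (by omega)) ⟨(u, v), by omega⟩
    have face_one : ∀ v, ∀ h : 0 < v + 2 ∧ v + 2 < q + 1, a ⟨(0, v + 2), h⟩ = 1 := by
      intro v h
      simpa [del2] using congrFun (ha 1 (by omega)) ⟨(0, v + 1), by omega⟩
    funext ⟨⟨u, v⟩, huv, hv⟩
    match u, v, huv, hv with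
    | u + 1, v + 1, huv, hv => exact face_zero u v ⟨huv, hv⟩
    | 0, v + 2, huv, hv => exact face_one v ⟨huv, hv⟩
    | 0, 1, huv, hv =>
      have hq2 : 2 ≤ q := by
        simp only at hv
        omega
      have face_two := congrFun (ha 2 hq2) ⟨(0, 1), by omega⟩
      simpa [del2, face_zero 0 1 (by omega), face_one 0 (by omega)] using face_two
  · funext ⟨⟨u, v⟩, huv, hv⟩
    simp only at huv hv
    omega
  · have : Unique (P2 2) :=
      { default := ⟨(0, 1), by omega⟩
        uniq := by
          rintro ⟨⟨u, v⟩, huv, hv⟩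
          simp only at huv hv
          simp only [Subtype.mk.injEq, Prod.mk.injEq]
          omega }
    exact ⟨MulEquiv.funUnique (P2 2) A⟩
end

section
/- For every q ≥ 0, the cyclic operator of K(A,2) satisfies τ_q^{q+1} = id as a map K_q → K_q. -/
variable {A : Type*} [CommGroup A]

/-- The element `(δφ)(u, v, v + 1)` of `K(A,2)` attached to a 1-cochain `φ` on `ZMod (q + 1)`. -/
def coboundary2 (q : ℕ) (φ : ZMod (q + 1) → ZMod (q + 1) → A) : K2 A q := fun p =>
  φ p.1.1 p.1.2 * φ p.1.2 (p.1.2 + 1) * (φ p.1.1 (p.1.2 + 1))⁻¹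

lemma prod_Ico_coboundary {q : ℕ} (φ : ZMod (q + 1) → ZMod (q + 1) → A) (x : ZMod (q + 1))
    {m n : ℕ} (h : m ≤ n) :
    ∏ t ∈ Finset.Ico m n, (φ x t * φ t (t + 1) * (φ x (t + 1))⁻¹) =
      φ x m * (φ x n)⁻¹ * ∏ t ∈ Finset.Ico m n, φ t (t + 1) := by
  induction n, h using Nat.le_induction with
  | base => simp
  | succ n h ih =>
    rw [Finset.prod_Ico_succ_top h, Finset.prod_Ico_succ_top h, ih, Nat.cast_succ]
    generalize ∏ t ∈ Finset.Ico m n, φ t (t + 1) = P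
    generalize φ x (n + 1) = b
    generalize φ x n = c
    rw [show φ x m * c⁻¹ * P * (c * φ n (n + 1) * b⁻¹)
      = φ x m * b⁻¹ * (P * φ n (n + 1)) * (c⁻¹ * c) by ac_rfl, inv_mul_cancel, mul_one]

lemma tau2_coboundary2 {q : ℕ} {φ : ZMod (q + 1) → ZMod (q + 1) → A}
    (hφ : ∀ x y, φ x y = (φ y x)⁻¹) :
    tau2 q (coboundary2 q φ) = coboundary2 q fun x y => φ (x - 1) (y - 1) := by
  funext ⟨⟨u, v⟩, huv, hvq⟩
  simp only at huv hvq
  obtain ⟨w, rfl⟩ : ∃ w, v = w + 1 := ⟨v - 1, by omega⟩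
  by_cases hu : u = 0
  · subst hu
    simp only [tau2, coboundary2, dite_true, Finset.prod_inv_distrib]
    rw [Finset.prod_attach (Finset.Ico (w + 1) q) (fun t : ℕ =>
        φ ((w + 1 - 1 : ℕ) : ZMod (q + 1)) t * φ t (t + 1) *
          (φ ((w + 1 - 1 : ℕ) : ZMod (q + 1)) (t + 1))⁻¹),
      Finset.prod_attach (Finset.Ico (w + 1 + 1) q) (fun t : ℕ =>
        φ ((w + 1 : ℕ) : ZMod (q + 1)) t * φ t (t + 1) *
          (φ ((w + 1 : ℕ) : ZMod (q + 1)) (t + 1))⁻¹),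
      prod_Ico_coboundary φ _ hvq.le, prod_Ico_coboundary φ _ hvq,
      Finset.prod_eq_prod_Ico_succ_bot hvq]
    have hq : (q : ZMod (q + 1)) = -1 := by
      rw [eq_neg_iff_add_eq_zero]
      exact_mod_cast ZMod.natCast_self (q + 1)
    simp only [hq, Nat.cast_succ, Nat.add_sub_cancel, add_sub_cancel_right, Nat.cast_zero, zero_sub]
    rw [hφ (-1) w, hφ (-1) (w + 1)]
    generalize ∏ t ∈ Finset.Ico (w + 1 + 1) q, φ t (t + 1) = P
    simp only [mul_inv, inv_inv]
    generalize φ (w + 1) (w + 1 + 1) = b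
    generalize φ w (-1) = c
    generalize φ (w + 1) (-1) = d
    generalize φ w (w + 1) = e
    rw [show e * c⁻¹ * (b * P) * (b⁻¹ * d * P⁻¹) = c⁻¹ * e * d * (b * b⁻¹) * (P * P⁻¹) by ac_rfl]
    simp
  · obtain ⟨s, rfl⟩ : ∃ s, u = s + 1 := ⟨u - 1, by omega⟩
    simp [tau2, coboundary2]

lemma iterate_tau2_coboundary2 {q : ℕ} {φ : ZMod (q + 1) → ZMod (q + 1) → A}
    (hφ : ∀ x y, φ x y = (φ y x)⁻¹) (n : ℕ) :
    (tau2 q)^[n] (coboundary2 q φ) = coboundary2 q fun x y => φ (x - n) (y - n) := by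
  induction n with
  | zero => simp
  | succ n ih =>
    rw [Function.iterate_succ_apply', ih, tau2_coboundary2 fun x y => hφ _ _]
    simp only [Nat.cast_succ, sub_sub, add_comm (1 : ZMod (q + 1))]

lemma exists_coboundary2_eq {q : ℕ} (a : K2 A q) :
    ∃ φ : ZMod (q + 1) → ZMod (q + 1) → A,
      (∀ x y, φ x y = (φ y x)⁻¹) ∧ coboundary2 q φ = a := by
  let b (u v : ℕ) : A := if h : u < v ∧ v < q then a ⟨(u, v), h⟩ else 1
  let c (u v : ℕ) : A := ∏ t ∈ Finset.Ico (u + 1) v, b u t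
  have hc {u v : ℕ} (h : v ≤ u + 1) : c u v = 1 := by
    simp only [c, Finset.Ico_eq_empty_of_le h, Finset.prod_empty]
  refine ⟨fun x y => (c x.val y.val)⁻¹ * c y.val x.val, fun x y => by simp [mul_comm], ?_⟩
  funext ⟨⟨u, v⟩, huv, hvq⟩
  simp only at huv hvq
  have hval {n : ℕ} (hn : n ≤ q) : (n : ZMod (q + 1)).val = n :=
    ZMod.val_cast_of_lt (Nat.lt_succ_of_le hn)
  have hsucc : c u (v + 1) = c u v * a ⟨(u, v), huv, hvq⟩ := by
    simp only [c, Finset.prod_Ico_succ_top (show u + 1 ≤ v from huv)]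
    simp [b, huv, hvq]
  simp only [coboundary2, ← Nat.cast_succ]
  rw [hval (by omega : u ≤ q), hval hvq.le, hval hvq, hc (by omega : u ≤ v + 1),
    hc (by omega : v ≤ v + 1 + 1), hc (le_refl (v + 1)), hc (by omega : u ≤ v + 1 + 1), hsucc]
  simp

/-- For every `q ≥ 0`, the cyclic operator of `K(A,2)` satisfies
`τ_q^{q+1} = id` as a map `K_q → K_q`. -/
theorem K2_cyclic_order (A : Type*) [CommGroup A] (q : ℕ) :
    (tau2 (A := A) q)^[q + 1] = id := by
  funext a
  obtain ⟨φ, hφ, rfl⟩ := exists_coboundary2_eq a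
  rw [iterate_tau2_coboundary2 hφ, ZMod.natCast_self]
  simp only [sub_zero, id]
end

section
/- The cyclic operator of K(A,2) is compatible with the face maps: for every q ≥ 1, ∂_0 ∘ τ_q = ∂_q as maps K_q → K_{q−1}, and ∂_i ∘ τ_q = τ_{q−1} ∘ ∂_{i−1} for all 1 ≤ i ≤ q. -/
variable {A : Type*} [CommGroup A]

/-- The extension of an element of `K2 A q` to all pairs of naturals by `1`. -/
def K2.extend {A : Type*} [CommGroup A] {q : ℕ} (a : K2 A q) (u v : ℕ) : A :=
  if h : u < v ∧ v < q then a ⟨(u, v), h⟩ else 1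

namespace K2

section

variable {A : Type*} [CommGroup A] {q : ℕ}

theorem extend_of_lt (a : K2 A q) {u v : ℕ} (h : u < v ∧ v < q) :
    a.extend u v = a ⟨(u, v), h⟩ :=
  dif_pos h

theorem del2_apply (i : ℕ) (a : K2 A (q + 1)) {u v : ℕ} (h : u < v ∧ v < q) :
    del2 q i a ⟨(u, v), h⟩ =
      if v + 1 < i then a.extend u v
      else if v + 1 = i then a.extend u v * a.extend u i * (a.extend v i)⁻¹
      else if u < i then a.extend u (v + 1)
      else a.extend (u + 1) (v + 1) := by
  unfold del2
  dsimp only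
  split_ifs
  · rw [extend_of_lt]
  · rw [extend_of_lt a (u := u) (v := v) (by omega), extend_of_lt a (u := u) (v := i) (by omega),
      extend_of_lt a (u := v) (v := i) (by omega)]
  · rw [extend_of_lt]
  · rw [extend_of_lt]

theorem tau2_apply_zero (a : K2 A q) {v : ℕ} (h : 0 < v ∧ v < q) :
    tau2 q a ⟨(0, v), h⟩ =
      (∏ t ∈ Finset.Ico v q, a.extend (v - 1) t) *
        ∏ t ∈ Finset.Ico (v + 1) q, (a.extend v t)⁻¹ := by
  rw [← Finset.prod_attach (Finset.Ico v q), ← Finset.prod_attach (Finset.Ico (v + 1) q)]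
  unfold tau2
  dsimp only
  rw [dif_pos rfl]
  congr 1
  · refine Finset.prod_congr rfl fun t _ => ?_
    rw [extend_of_lt]
  · refine Finset.prod_congr rfl fun t _ => ?_
    rw [extend_of_lt]

theorem tau2_apply_succ (a : K2 A q) {u v : ℕ} (h : u + 1 < v + 1 ∧ v + 1 < q) :
    tau2 q a ⟨(u + 1, v + 1), h⟩ = a.extend u v := by
  rw [extend_of_lt a (by omega)]
  rfl

theorem extend_tau2_succ (a : K2 A q) {u v : ℕ} (h : u < v ∧ v + 1 < q) :
    (tau2 q a).extend (u + 1) (v + 1) = a.extend u v := by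
  rw [extend_of_lt _ (by omega), tau2_apply_succ]

theorem prod_extend_del2_of_lt (a : K2 A (q + 1)) {u m k : ℕ} (hu : u < m) (hm : m ≤ k)
    (hk : k < q) :
    ∏ t ∈ Finset.Ico m q, (del2 q (k + 1) a).extend u t =
      (∏ t ∈ Finset.Ico m (q + 1), a.extend u t) * (a.extend k (k + 1))⁻¹ := by
  rw [← Finset.prod_Ico_consecutive _ hm hk.le, Finset.prod_eq_prod_Ico_succ_bot hk,
    ← Finset.prod_Ico_consecutive (fun t => a.extend u t) hm (by omega : k ≤ q + 1),
    Finset.prod_eq_prod_Ico_succ_bot (by omega : k < q + 1),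
    Finset.prod_eq_prod_Ico_succ_bot (by omega : k + 1 < q + 1),
    ← Finset.prod_Ico_add' (fun t => a.extend u t) (k + 1) q 1]
  have below : ∏ t ∈ Finset.Ico m k, (del2 q (k + 1) a).extend u t =
      ∏ t ∈ Finset.Ico m k, a.extend u t := by
    refine Finset.prod_congr rfl fun t ht => ?_
    rw [Finset.mem_Ico] at ht
    rw [extend_of_lt _ (by omega), del2_apply, if_pos (by omega)]
  have above : ∏ t ∈ Finset.Ico (k + 1) q, (del2 q (k + 1) a).extend u t =
      ∏ t ∈ Finset.Ico (k + 1) q, a.extend u (t + 1) := by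
    refine Finset.prod_congr rfl fun t ht => ?_
    rw [Finset.mem_Ico] at ht
    rw [extend_of_lt _ (by omega), del2_apply, if_neg (by omega), if_neg (by omega),
      if_pos (by omega)]
  have middle : (del2 q (k + 1) a).extend u k =
      a.extend u k * a.extend u (k + 1) * (a.extend k (k + 1))⁻¹ := by
    rw [extend_of_lt _ (by omega), del2_apply, if_neg (by omega), if_pos rfl]
  rw [below, above, middle]
  simp only [mul_assoc, mul_comm, mul_left_comm]

theorem prod_extend_del2_of_le (a : K2 A (q + 1)) {u m j : ℕ} (hu : u < j) (hj : j ≤ m) :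
    ∏ t ∈ Finset.Ico m q, (del2 q j a).extend u t =
      ∏ t ∈ Finset.Ico (m + 1) (q + 1), a.extend u t := by
  rw [← Finset.prod_Ico_add' (fun t => a.extend u t) m q 1]
  refine Finset.prod_congr rfl fun t ht => ?_
  rw [Finset.mem_Ico] at ht
  rw [extend_of_lt _ (by omega), del2_apply, if_neg (by omega), if_neg (by omega),
    if_pos (by omega)]

theorem prod_extend_del2_of_le_left (a : K2 A (q + 1)) {u m j : ℕ} (hj : j ≤ u) (hu : u < m) :
    ∏ t ∈ Finset.Ico m q, (del2 q j a).extend u t =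
      ∏ t ∈ Finset.Ico (m + 1) (q + 1), a.extend (u + 1) t := by
  rw [← Finset.prod_Ico_add' (fun t => a.extend (u + 1) t) m q 1]
  refine Finset.prod_congr rfl fun t ht => ?_
  rw [Finset.mem_Ico] at ht
  rw [extend_of_lt _ (by omega), del2_apply, if_neg (by omega), if_neg (by omega),
    if_neg (by omega)]

theorem del2_zero_tau2 (a : K2 A (q + 1)) : del2 q 0 (tau2 (q + 1) a) = del2 q (q + 1) a := by
  funext ⟨⟨u, v⟩, h⟩
  dsimp only at h
  rw [del2_apply, del2_apply, if_neg (by omega), if_neg (by omega), if_neg (by omega),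
    if_pos (by omega), extend_tau2_succ a (by omega)]

theorem del2_succ_tau2_apply_zero {j : ℕ} (hj : j ≤ q) (a : K2 A (q + 1)) {v : ℕ}
    (h : 0 < v + 1 ∧ v + 1 < q) :
    del2 q (j + 1) (tau2 (q + 1) a) ⟨(0, v + 1), h⟩ =
      tau2 q (del2 q j a) ⟨(0, v + 1), h⟩ := by
  rw [del2_apply, tau2_apply_zero, Nat.add_sub_cancel, Finset.prod_inv_distrib]
  rcases lt_trichotomy (v + 1) j with hv | rfl | hv
  · obtain ⟨k, rfl⟩ : ∃ k, j = k + 1 := ⟨j - 1, by omega⟩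
    rw [if_pos (by omega), extend_of_lt _ (by omega), tau2_apply_zero, Nat.add_sub_cancel,
      Finset.prod_inv_distrib, prod_extend_del2_of_lt a (by omega) (by omega) (by omega)]
    rcases (show v + 1 ≤ k by omega).eq_or_lt with rfl | hk
    · rw [prod_extend_del2_of_le a (by omega) le_rfl,
        Finset.prod_eq_prod_Ico_succ_bot (by omega : v + 1 + 1 < q + 1) (a.extend (v + 1)),
        mul_inv, mul_assoc]
    · rw [prod_extend_del2_of_lt a (by omega) (by omega) (by omega), mul_inv, inv_inv]
      rw [mul_mul_mul_comm, inv_mul_cancel, mul_one]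
  · rw [if_neg (by omega), if_pos rfl, extend_of_lt _ (by omega), tau2_apply_zero,
      extend_of_lt _ (by omega), tau2_apply_zero, extend_tau2_succ a (by omega),
      prod_extend_del2_of_le a (by omega) le_rfl,
      prod_extend_del2_of_le_left a le_rfl (by omega),
      Finset.prod_inv_distrib, Finset.prod_inv_distrib, Nat.add_sub_cancel, Nat.add_sub_cancel,
      Finset.prod_eq_prod_Ico_succ_bot (by omega : v + 1 < q + 1) (a.extend v)]
    simp only [← div_eq_mul_inv]
    rw [div_mul_div_cancel, div_right_comm, mul_div_cancel_left]
  · rw [if_neg (by omega), if_neg (by omega), if_pos (by omega), extend_of_lt _ (by omega),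
      tau2_apply_zero, prod_extend_del2_of_le_left a (by omega) (by omega),
      prod_extend_del2_of_le_left a (by omega) (by omega), Nat.add_sub_cancel,
      Finset.prod_inv_distrib]

theorem del2_succ_tau2_apply_succ {j : ℕ} (a : K2 A (q + 1)) {u v : ℕ}
    (h : u + 1 < v + 1 ∧ v + 1 < q) :
    del2 q (j + 1) (tau2 (q + 1) a) ⟨(u + 1, v + 1), h⟩ =
      tau2 q (del2 q j a) ⟨(u + 1, v + 1), h⟩ := by
  rw [del2_apply, tau2_apply_succ, extend_of_lt (del2 q j a) (by omega), del2_apply]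
  simp only [Nat.add_lt_add_iff_right, Nat.add_right_cancel_iff]
  split_ifs
  · rw [extend_tau2_succ a (by omega)]
  · rw [extend_tau2_succ a (by omega), extend_tau2_succ a (by omega),
      extend_tau2_succ a (by omega)]
  · rw [extend_tau2_succ a (by omega)]
  · rw [extend_tau2_succ a (by omega)]

theorem del2_succ_tau2 {j : ℕ} (hj : j ≤ q) (a : K2 A (q + 1)) :
    del2 q (j + 1) (tau2 (q + 1) a) = tau2 q (del2 q j a) := by
  funext ⟨⟨u, v⟩, h⟩
  dsimp only at h
  obtain ⟨w, rfl⟩ : ∃ w, v = w + 1 := ⟨v - 1, by omega⟩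
  cases u with
  | zero => exact del2_succ_tau2_apply_zero hj a h
  | succ u => exact del2_succ_tau2_apply_succ a h

end

end K2

/-- The cyclic operator of `K(A,2)` is compatible with the face maps:
for every `q ≥ 1` (here `q+1`), `∂₀ ∘ τ_q = ∂_q` as maps `K_q → K_{q-1}`, and
`∂ᵢ ∘ τ_q = τ_{q-1} ∘ ∂_{i-1}` for all `1 ≤ i ≤ q`. -/
theorem K2_cyclic_face (A : Type*) [CommGroup A] (q : ℕ) :
    ((del2 (A := A) q 0) ∘ (tau2 (q + 1)) = del2 q (q + 1)) ∧
    (∀ i : ℕ, ∀ h1 : 1 ≤ i, ∀ h2 : i ≤ q + 1,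
      (del2 (A := A) q i) ∘ (tau2 (q + 1)) = (tau2 q) ∘ (del2 q (i - 1))) := by
  refine ⟨funext K2.del2_zero_tau2, fun i h1 h2 => ?_⟩
  obtain ⟨j, rfl⟩ : ∃ j, i = j + 1 := ⟨i - 1, by omega⟩
  exact funext (K2.del2_succ_tau2 (by omega))
end

section
/- The cyclic operator of K(A,2) is compatible with the degeneracy maps: for every q ≥ 0, s_i ∘ τ_q = τ_{q+1} ∘ s_{i−1} for all 1 ≤ i ≤ q, and s_0 ∘ τ_q = τ_{q+1}^2 ∘ s_q as maps K_q → K_{q+1}. Together with the face compatibilities and τ_q^{q+1} = id this makes (K_q, ∂_i, s_i, τ_q) a cyclic object. -/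
variable {A : Type*} [CommGroup A]

/-- Extension of `a : K2 A q` by `1` to all pairs of natural numbers. -/
def K2.entry {q : ℕ} (a : K2 A q) (u v : ℕ) : A :=
  if h : u < v ∧ v < q then a ⟨(u, v), h⟩ else 1

/-- The product of all entries in row `u`. -/
def K2.row {q : ℕ} (a : K2 A q) (u : ℕ) : A :=
  ∏ t ∈ Finset.range q, a.entry u t

theorem K2.ext_entry {q : ℕ} {a b : K2 A q}
    (h : ∀ u v, u < v → v < q → a.entry u v = b.entry u v) : a = b := by
  funext ⟨⟨u, v⟩, huv⟩
  simpa [K2.entry, huv] using h u v huv.1 huv.2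

theorem K2.row_eq_prod_Ico {q : ℕ} (a : K2 A q) {u : ℕ} (hu : u < q) :
    a.row u = ∏ t ∈ Finset.Ico (u + 1) q, a.entry u t := by
  rw [K2.row, Finset.range_eq_Ico, ← Finset.prod_Ico_consecutive _ (Nat.zero_le (u + 1)) hu,
    Finset.prod_eq_one, one_mul]
  intro t ht
  rw [Finset.mem_Ico] at ht
  exact dif_neg (by omega)

theorem K2.row_of_le {q : ℕ} (a : K2 A q) {u : ℕ} (hu : q ≤ u + 1) : a.row u = 1 := by
  refine Finset.prod_eq_one fun t ht => ?_
  rw [Finset.mem_range] at ht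
  exact dif_neg (by omega)

theorem entry_s2 {q i : ℕ} (hi : i ≤ q) (a : K2 A q) (u v : ℕ) :
    (s2 q i hi a).entry u v =
      if v = i then 1
      else a.entry (if u ≤ i then u else u - 1) (if v < i then v else v - 1) := by
  unfold K2.entry s2
  grind

theorem row_s2 {q i : ℕ} (hi : i ≤ q) (a : K2 A q) (u : ℕ) :
    (s2 q i hi a).row u = a.row (if u ≤ i then u else u - 1) := by
  unfold K2.row
  rw [Finset.prod_range, Fin.prod_univ_succAbove _ ⟨i, by omega⟩, Finset.prod_range,
    entry_s2, if_pos rfl, one_mul]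
  refine Finset.prod_congr rfl fun t _ => ?_
  rw [entry_s2]
  by_cases ht : t.1 < i <;> simp [Fin.succAbove, Fin.lt_def, ht] <;> grind

theorem entry_zero_tau2 {q : ℕ} (a : K2 A q) {v : ℕ} (hv : 0 < v) (hvq : v < q) :
    (tau2 q a).entry 0 v = a.row (v - 1) * (a.row v)⁻¹ := by
  rw [K2.row_eq_prod_Ico a hvq, K2.row_eq_prod_Ico a (by omega : v - 1 < q),
    Nat.sub_add_cancel hv, ← Finset.prod_inv_distrib, ← Finset.prod_attach (Finset.Ico v q),
    ← Finset.prod_attach (Finset.Ico (v + 1) q)]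
  rw [K2.entry, dif_pos ⟨hv, hvq⟩, tau2, dif_pos rfl]
  congr 1 <;> refine Finset.prod_congr rfl fun t _ => ?_ <;>
    have ht := Finset.mem_Ico.mp t.2 <;> dsimp only at ht <;>
    rw [K2.entry, dif_pos (by omega)]

theorem entry_succ_tau2 {q : ℕ} (a : K2 A q) {u v : ℕ} (hvq : v + 1 < q) :
    (tau2 q a).entry (u + 1) (v + 1) = a.entry u v := by
  unfold K2.entry tau2
  grind

theorem row_zero_tau2 {q : ℕ} (a : K2 A q) : (tau2 q a).row 0 = a.row 0 := by
  rcases q with _ | q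
  · simp [K2.row]
  · have h : ∀ t ∈ Finset.range q, (tau2 (q + 1) a).entry 0 (t + 1) = a.row t / a.row (t + 1) := by
      intro t ht
      rw [Finset.mem_range] at ht
      rw [entry_zero_tau2 a (by omega) (by omega), Nat.add_sub_cancel, div_eq_mul_inv]
    rw [K2.row, Finset.prod_range_succ', Finset.prod_congr rfl h, Finset.prod_range_div',
      K2.row_of_le a le_rfl]
    simp [K2.entry]

theorem row_succ_tau2 {q : ℕ} (a : K2 A (q + 1)) (u : ℕ) :
    (tau2 (q + 1) a).row (u + 1) * a.entry u q = a.row u := by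
  have h : ∀ t ∈ Finset.range q, (tau2 (q + 1) a).entry (u + 1) (t + 1) = a.entry u t := by
    intro t ht
    rw [Finset.mem_range] at ht
    exact entry_succ_tau2 a (by omega)
  rw [K2.row, Finset.prod_range_succ', Finset.prod_congr rfl h, K2.row, Finset.prod_range_succ,
    K2.entry, dif_neg (by omega), mul_one]

theorem row_succ_tau2_s2_last {q : ℕ} (a : K2 A q) {u : ℕ} (hu : u ≤ q) :
    (tau2 (q + 1) (s2 q q le_rfl a)).row (u + 1) = a.row u := by
  have h := row_succ_tau2 (s2 q q le_rfl a) u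
  rwa [entry_s2, if_pos rfl, mul_one, row_s2, if_pos hu] at h

theorem s2_tau2 {q i : ℕ} (hi : i + 1 ≤ q) (a : K2 A q) :
    s2 q (i + 1) hi (tau2 q a) = tau2 (q + 1) (s2 q i (by omega) a) := by
  refine K2.ext_entry fun u v huv hvq => ?_
  obtain ⟨v, rfl⟩ : ∃ w, v = w + 1 := ⟨v - 1, by omega⟩
  rw [entry_s2]
  rcases u with _ | u
  · rw [entry_zero_tau2 _ (by omega) hvq, row_s2, row_s2, Nat.add_sub_cancel]
    rcases lt_trichotomy v i with h | rfl | h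
    · rw [if_neg (by omega), if_pos (by omega), if_pos (by omega), if_pos (by omega),
        if_pos (by omega), entry_zero_tau2 _ (by omega) (by omega), Nat.add_sub_cancel]
    · simp
    · rw [if_neg (by omega), if_pos (by omega), if_neg (by omega), if_neg (by omega),
        if_neg (by omega), entry_zero_tau2 _ (by omega) (by omega)]
  · rw [entry_succ_tau2 _ hvq, entry_s2]
    rcases lt_trichotomy v i with h | rfl | h
    · rw [if_neg (by omega), if_pos (by omega), if_pos (by omega), if_neg (by omega),
        if_pos (by omega), if_pos (by omega), entry_succ_tau2 _ (by omega)]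
    · simp
    · obtain ⟨v, rfl⟩ : ∃ w, v = w + 1 := ⟨v - 1, by omega⟩
      rw [if_neg (by omega), if_neg (by omega : ¬v + 1 + 1 < i + 1),
        if_neg (by omega : ¬v + 1 = i), if_neg (by omega : ¬v + 1 < i), Nat.add_sub_cancel,
        Nat.add_sub_cancel]
      by_cases hu : u ≤ i
      · rw [if_pos (by omega), if_pos hu, entry_succ_tau2 _ (by omega), Nat.add_sub_cancel]
      · obtain ⟨u, rfl⟩ : ∃ w, u = w + 1 := ⟨u - 1, by omega⟩
        rw [if_neg (by omega), if_neg hu, Nat.add_sub_cancel, Nat.add_sub_cancel,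
          entry_succ_tau2 _ (by omega)]

theorem s2_zero_tau2 {q : ℕ} (a : K2 A q) :
    s2 q 0 (Nat.zero_le q) (tau2 q a) = tau2 (q + 1) (tau2 (q + 1) (s2 q q le_rfl a)) := by
  refine K2.ext_entry fun u v huv hvq => ?_
  obtain ⟨v, rfl⟩ : ∃ w, v = w + 1 := ⟨v - 1, by omega⟩
  rw [entry_s2, if_neg (by omega), if_neg (by omega : ¬v + 1 < 0), Nat.add_sub_cancel]
  rcases u with _ | u
  · rw [entry_zero_tau2 _ (by omega) hvq, Nat.add_sub_cancel, row_succ_tau2_s2_last _ (by omega),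
      if_pos le_rfl]
    rcases v with _ | v
    · rw [row_zero_tau2, row_s2, if_pos (Nat.zero_le q), mul_inv_cancel]
      exact dif_neg (by omega)
    · rw [row_succ_tau2_s2_last _ (by omega), entry_zero_tau2 _ (by omega) (by omega),
        Nat.add_sub_cancel]
  · rw [entry_succ_tau2 _ hvq, if_neg (by omega), Nat.add_sub_cancel]
    obtain ⟨v, rfl⟩ : ∃ w, v = w + 1 := ⟨v - 1, by omega⟩
    rcases u with _ | u
    · rw [entry_zero_tau2 _ (by omega) (by omega), entry_zero_tau2 _ (by omega) (by omega),
        row_s2, row_s2, if_pos (by omega), if_pos (by omega)]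
    · rw [entry_succ_tau2 _ (by omega), entry_succ_tau2 _ (by omega), entry_s2,
        if_neg (by omega), if_pos (by omega), if_pos (by omega)]

/-- The cyclic operator of `K(A,2)` is compatible with the degeneracy maps:
for every `q ≥ 0`, `sᵢ ∘ τ_q = τ_{q+1} ∘ s_{i-1}` for all `1 ≤ i ≤ q`, and
`s₀ ∘ τ_q = τ_{q+1}² ∘ s_q` as maps `K_q → K_{q+1}`.  (Together with the face
compatibilities and `τ_q^{q+1} = id` this makes `(K_q, ∂ᵢ, sᵢ, τ_q)` a cyclic object.) -/
theorem K2_cyclic_degen (A : Type*) [CommGroup A] (q : ℕ) :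
    (∀ i : ℕ, ∀ h1 : 1 ≤ i, ∀ h2 : i ≤ q,
      (s2 (A := A) q i h2) ∘ (tau2 q) = (tau2 (q + 1)) ∘ (s2 q (i - 1) (by omega))) ∧
    ((s2 (A := A) q 0 (by omega)) ∘ (tau2 q) =
      (tau2 (q + 1)) ∘ (tau2 (q + 1)) ∘ (s2 q q le_rfl)) := by
  refine ⟨fun i h1 h2 => funext fun a => ?_, funext s2_zero_tau2⟩
  obtain ⟨i, rfl⟩ : ∃ j, i = j + 1 := ⟨i - 1, by omega⟩
  exact s2_tau2 h2 a
end

section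
/- For every q ≥ 2 and all indices 0 ≤ i < j ≤ q, the face maps of the simplicial group K(A,3) satisfy ∂_i ∘ ∂_j = ∂_{j−1} ∘ ∂_i as group homomorphisms K_q → K_{q−2}. -/
/-!
Explicit simplicial group `K(A,3)` (Staic).  Degree `q` part is
`K3 A q = A^{q(q-1)(q-2)/6}`, functions on triples `0 ≤ u < v < w ≤ q-1`.
-/

/-- Index set for `K(A,3)` in degree `q`: triples `(u,v,w)` with `0 ≤ u < v < w ≤ q-1`. -/
abbrev P3 (q : ℕ) : Type := {t : ℕ × ℕ × ℕ // t.1 < t.2.1 ∧ t.2.1 < t.2.2 ∧ t.2.2 < q}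

/-- `K(A,3)` in degree `q`. -/
abbrev K3 (A : Type*) [CommGroup A] (q : ℕ) : Type _ := P3 q → A

variable {A : Type*} [CommGroup A]

/-- The face map `∂ᵢ : K_{q+1} → K_q` of `K(A,3)`:
`b_{u,v,w} = a_{u,v,w}` if `u < v < w < i-1`,
`b_{u,v,w} = a_{u,v,w} a_{u,v,i} a_{u,w,i}⁻¹ a_{v,w,i}` if `u < v < w = i-1`,
`b_{u,v,w} = a_{u,v,w+1}` if `u < v ≤ i-1 < w`,
`b_{u,v,w} = a_{u,v+1,w+1}` if `u ≤ i-1 < v < w`, and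
`b_{u,v,w} = a_{u+1,v+1,w+1}` if `i-1 < u < v < w`. -/
def del3 (q i : ℕ) (a : K3 A (q + 1)) : K3 A q := fun p =>
  have h1 : p.1.1 < p.1.2.1 := p.2.1
  have h2 : p.1.2.1 < p.1.2.2 := p.2.2.1
  have h3 : p.1.2.2 < q := p.2.2.2
  if hw1 : p.1.2.2 + 1 < i then a ⟨(p.1.1, p.1.2.1, p.1.2.2), by dsimp only; omega⟩
  else if hw2 : p.1.2.2 + 1 = i then
    a ⟨(p.1.1, p.1.2.1, p.1.2.2), by dsimp only; omega⟩ * a ⟨(p.1.1, p.1.2.1, i), by dsimp only; omega⟩ *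
      (a ⟨(p.1.1, p.1.2.2, i), by dsimp only; omega⟩)⁻¹ * a ⟨(p.1.2.1, p.1.2.2, i), by dsimp only; omega⟩
  else if hv : p.1.2.1 < i then a ⟨(p.1.1, p.1.2.1, p.1.2.2 + 1), by dsimp only; omega⟩
  else if hu : p.1.1 < i then a ⟨(p.1.1, p.1.2.1 + 1, p.1.2.2 + 1), by dsimp only; omega⟩
  else a ⟨(p.1.1 + 1, p.1.2.1 + 1, p.1.2.2 + 1), by dsimp only; omega⟩

/-- The degeneracy map `sᵢ : K_q → K_{q+1}` of `K(A,3)`: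
`c_{u,v,w} = a_{u,v,w}` if `u < v < w < i`; `c_{u,v,w} = 1` if `u < v < w = i`,
or `u < v = i = w-1`, or `u = i = v-1 < w-1`;
`c_{u,v,w} = a_{u,v,w-1}` if `u < v < i < w` or `u < v = i < w-1`;
`c_{u,v,w} = a_{u,v-1,w-1}` if `u < i < v < w` or `u = i < v-1 < w-1`; and
`c_{u,v,w} = a_{u-1,v-1,w-1}` if `i < u < v < w`. -/
def s3 (q i : ℕ) (hi : i ≤ q) (a : K3 A q) : K3 A (q + 1) := fun p =>
  have h1 : p.1.1 < p.1.2.1 := p.2.1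
  have h2 : p.1.2.1 < p.1.2.2 := p.2.2.1
  have h3 : p.1.2.2 < q + 1 := p.2.2.2
  if hw1 : p.1.2.2 < i then a ⟨(p.1.1, p.1.2.1, p.1.2.2), by dsimp only; omega⟩
  else if hw2 : p.1.2.2 = i then 1
  else if hv1 : p.1.2.1 < i then a ⟨(p.1.1, p.1.2.1, p.1.2.2 - 1), by dsimp only; omega⟩
  else if hv2 : p.1.2.1 = i then
    (if hw3 : p.1.2.2 = i + 1 then 1 else a ⟨(p.1.1, p.1.2.1, p.1.2.2 - 1), by dsimp only; omega⟩)
  else if hu1 : p.1.1 < i then a ⟨(p.1.1, p.1.2.1 - 1, p.1.2.2 - 1), by dsimp only; omega⟩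
  else if hu2 : p.1.1 = i then
    (if hv3 : p.1.2.1 = i + 1 then 1 else a ⟨(p.1.1, p.1.2.1 - 1, p.1.2.2 - 1), by dsimp only; omega⟩)
  else a ⟨(p.1.1 - 1, p.1.2.1 - 1, p.1.2.2 - 1), by dsimp only; omega⟩

/-- The formula for `∂ᵢ` on families indexed by all triples of natural numbers. -/
def faceFormula (i : ℕ) (f : ℕ → ℕ → ℕ → A) (u v w : ℕ) : A :=
  if w + 1 < i then f u v w
  else if w + 1 = i then f u v w * f u v i * (f u w i)⁻¹ * f v w i
  else if v < i then f u v (w + 1)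
  else if u < i then f u (v + 1) (w + 1)
  else f (u + 1) (v + 1) (w + 1)

/-- The element of `K3 A q` obtained by restricting a family indexed by all triples. -/
def restrictK3 (q : ℕ) (f : ℕ → ℕ → ℕ → A) : K3 A q := fun p => f p.1.1 p.1.2.1 p.1.2.2

theorem restrictK3_surjective (q : ℕ) : Function.Surjective (restrictK3 (A := A) q) := by
  intro a
  refine ⟨fun u v w => if h : u < v ∧ v < w ∧ w < q then a ⟨(u, v, w), h⟩ else 1, ?_⟩
  funext p
  exact dif_pos p.2

theorem del3_restrictK3 (q i : ℕ) (f : ℕ → ℕ → ℕ → A) :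
    del3 q i (restrictK3 (q + 1) f) = restrictK3 q (faceFormula i f) := rfl

/-- The only case in which the group law matters: `∂ᵢ ∂ᵢ₊₁ = ∂ᵢ ∂ᵢ` at `w = i - 1`. -/
theorem faceFormula_comp_of_last (f : ℕ → ℕ → ℕ → A) {u v w : ℕ} (hvw : v < w) :
    faceFormula (w + 1) (faceFormula (w + 2) f) u v w =
      faceFormula (w + 1) (faceFormula (w + 1) f) u v w := by
  have cancel (x a b c d e g r s t : Additive A) :
      x + (a + b + -r + s) + -(c + d + -r + t) + (e + g + -s + t) =
        x + a + -c + e + b + -d + g := by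
    abel
  unfold faceFormula
  simp (disch := omega) only [if_pos, if_neg]
  exact cancel _ _ _ _ _ _ _ _ _ _

theorem faceFormula_comp (f : ℕ → ℕ → ℕ → A) {i k u v w : ℕ} (hik : i ≤ k) (huv : u < v)
    (hvw : v < w) :
    faceFormula i (faceFormula (k + 1) f) u v w = faceFormula k (faceFormula i f) u v w := by
  by_cases hlast : w + 1 = i ∧ i = k
  · obtain ⟨rfl, rfl⟩ := hlast
    exact faceFormula_comp_of_last f hvw
  · unfold faceFormula
    rcases lt_trichotomy (w + 1) k with hwk | hwk | hwk <;>
    rcases lt_trichotomy (w + 1) i with hwi | hwi | hwi <;>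
    rcases lt_or_ge v i with hvi | hvi <;>
    rcases lt_or_ge u i with hui | hui <;>
    rcases lt_or_ge v k with hvk | hvk <;>
    rcases lt_or_ge u k with huk | huk <;>
    first
      | omega
      | simp (disch := omega) only [if_pos, if_neg]

/-- For every `q ≥ 2` (here `q+2`) and all `0 ≤ i < j ≤ q`, the face maps of
the simplicial group `K(A,3)` satisfy `∂ᵢ ∘ ∂ⱼ = ∂_{j-1} ∘ ∂ᵢ` as group homomorphisms
`K_q → K_{q-2}`. -/
theorem K3_face_face (A : Type*) [CommGroup A] (q i j : ℕ) (hij : i < j) (hj : j ≤ q + 2) :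
    (del3 (A := A) q i) ∘ (del3 (q + 1) j) = (del3 q (j - 1)) ∘ (del3 (q + 1) i) := by
  obtain ⟨k, rfl⟩ : ∃ k, j = k + 1 := ⟨j - 1, by omega⟩
  funext a
  obtain ⟨f, rfl⟩ := restrictK3_surjective _ a
  simp only [Function.comp_apply, del3_restrictK3, Nat.add_sub_cancel]
  funext p
  exact faceFormula_comp f (Nat.lt_succ_iff.mp hij) p.2.1 p.2.2.1
end

section
/- For every q ≠ 3, the Moore complex of K(A,3) is trivial in degree q: if an element (a_{u,v,w}) ∈ K_q satisfies ∂_i((a_{u,v,w})) = 1 for all 0 ≤ i ≤ q−1, then (a_{u,v,w}) = 1. Consequently the homotopy groups of the simplicial group K(A,3) are π_3 ≅ A and π_q = 0 for q ≠ 3. -/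
variable {A : Type*} [CommGroup A]

/-- An element of `K(A,3)` in degree `q + 1 ≥ 4` killed by `∂₀, …, ∂_q` is trivial. -/
theorem eq_one_of_del3_eq_one {q : ℕ} (hq : 3 ≤ q) (a : K3 A (q + 1))
    (ha : ∀ i ≤ q, del3 q i a = 1) : a = 1 := by
  have face : ∀ i ≤ q, ∀ p, del3 q i a p = 1 := fun i hi p => congrFun (ha i hi) p
  have of_pos : ∀ u v w (h : u < v ∧ v < w ∧ w < q + 1), 0 < u → a ⟨(u, v, w), h⟩ = 1 := by
    intro u v w h hu
    obtain ⟨u, rfl⟩ := Nat.exists_eq_add_one.mpr hu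
    obtain ⟨v, rfl⟩ : ∃ k, v = k + 1 := ⟨v - 1, by omega⟩
    obtain ⟨w, rfl⟩ : ∃ k, w = k + 1 := ⟨w - 1, by omega⟩
    simpa [del3] using face 0 (by omega) ⟨(u, v, w), by dsimp only; omega⟩
  have of_gap_left : ∀ u v w (h : u < v ∧ v < w ∧ w < q + 1), u + 1 < v →
      a ⟨(u, v, w), h⟩ = 1 := by
    intro u v w h huv
    obtain ⟨v, rfl⟩ : ∃ k, v = k + 1 := ⟨v - 1, by omega⟩
    obtain ⟨w, rfl⟩ : ∃ k, w = k + 1 := ⟨w - 1, by omega⟩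
    have := face (u + 1) (by omega) ⟨(u, v, w), by dsimp only; omega⟩
    simp only [del3] at this
    rwa [dif_neg (by omega), dif_neg (by omega), dif_neg (by omega), dif_pos (by omega)] at this
  have of_gap_right : ∀ u v w (h : u < v ∧ v < w ∧ w < q + 1), v + 1 < w →
      a ⟨(u, v, w), h⟩ = 1 := by
    intro u v w h hvw
    obtain ⟨w, rfl⟩ : ∃ k, w = k + 1 := ⟨w - 1, by omega⟩
    have := face (v + 1) (by omega) ⟨(u, v, w), by dsimp only; omega⟩
    simp only [del3] at this
    rwa [dif_neg (by omega), dif_neg (by omega), dif_pos (by omega)] at this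
  have initial : a ⟨(0, 1, 2), by dsimp only; omega⟩ = 1 := by
    have := face 3 hq ⟨(0, 1, 2), by dsimp only; omega⟩
    simpa [del3, of_gap_right 0 1 3, of_gap_left 0 2 3, of_pos 1 2 3] using this
  funext ⟨⟨u, v, w⟩, h⟩
  dsimp only at h
  rcases Nat.eq_zero_or_pos u with rfl | hu
  · by_cases huv : 0 + 1 < v
    · exact of_gap_left 0 v w h huv
    by_cases hvw : v + 1 < w
    · exact of_gap_right 0 v w h hvw
    obtain rfl : v = 1 := by omega
    obtain rfl : w = 2 := by omega
    exact initial
  · exact of_pos u v w h hu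

theorem isEmpty_P3 {q : ℕ} (hq : q < 3) : IsEmpty (P3 q) :=
  ⟨fun ⟨⟨_, _, _⟩, h⟩ => by dsimp only at h; omega⟩

/-- The only index in degree `3` is `(0, 1, 2)`. -/
instance : Unique (P3 3) where
  default := ⟨(0, 1, 2), by decide⟩
  uniq := fun ⟨⟨u, v, w⟩, h⟩ => by
    dsimp only at h
    apply Subtype.ext
    simp only [Prod.mk.injEq]
    omega

/-- For every `q ≠ 3` the Moore complex of `K(A,3)` is trivial in degree `q`:
if `a ∈ K_q` satisfies `∂ᵢ a = 1` for all `0 ≤ i ≤ q-1` then `a = 1`.  Consequently (the Moore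
complex being all of `K_3 ≅ A` in degree `3`, with trivial differentials in and out) the
homotopy groups of `K(A,3)` are `π₃ ≅ A` and `π_q = 0` for `q ≠ 3`. -/
theorem K3_moore_trivial (A : Type*) [CommGroup A] :
    (∀ a : K3 A 0, a = 1) ∧
    (∀ q : ℕ, q + 1 ≠ 3 → ∀ a : K3 A (q + 1),
      (∀ i : ℕ, i ≤ q → del3 q i a = 1) → a = 1) ∧
    (∀ a : K3 A 3, ∀ i : ℕ, i ≤ 2 → del3 2 i a = 1) ∧
    Nonempty (K3 A 3 ≃* A) := by
  have eq_one {q : ℕ} (hq : q < 3) (a : K3 A q) : a = 1 :=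
    funext fun p => ((isEmpty_P3 hq).false p).elim
  refine ⟨eq_one (by omega), fun q hq a ha => ?_, fun a i _ => eq_one (by omega) _,
    ⟨MulEquiv.funUnique (P3 3) A⟩⟩
  rcases lt_or_ge (q + 1) 3 with h | h
  · exact eq_one h a
  · exact eq_one_of_del3_eq_one (by omega) a ha
end
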